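/- Let G be a finite subgroup of SL(2, ℂ) with |G| ≥ 3, let V be the natural two-dimensional representation of G, and let S and T be simple finite-dimensional complex representations of G. Then dim_ℂ Hom_G(T, V ⊗ S) ≤ 1. (Equivalently: in the McKay quiver of G ⊂ SL(2,ℂ), there is at most one arrow from any vertex to any other vertex.) -/

import Mathlib

open CategoryTheory CategoryTheory.MonoidalCategory Module

/-- The natural two-dimensional complex representation of a subgroup `G` of `SL(2, ℂ)`,
acting on `ℂ² = Fin 2 → ℂ` by matrix multiplication. -/
noncomputable def SL2.natRep (G : Subgroup (Matrix.SpecialLinearGroup (Fin 2) ℂ)) :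
    Representation ℂ G (Fin 2 → ℂ) :=
  LinearEquiv.automorphismGroup.toLinearMapMonoidHom.comp
    (Matrix.SpecialLinearGroup.toLin'.comp G.subtype)

/-- The natural representation of `G ⊆ SL(2, ℂ)` as an object of `FDRep ℂ G`. -/
noncomputable def SL2.natV (G : Subgroup (Matrix.SpecialLinearGroup (Fin 2) ℂ)) :
    FDRep ℂ G :=
  FDRep.of (SL2.natRep G)

open scoped ComplexOrder in
open Matrix in
/-- For a matrix representation of a finite group, the trace of the inverse is the conjugate. -/
theorem mckayAux_trace_inv {G : Type} [Group G] [Fintype G] {n : Type} [Fintype n] [DecidableEq n]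
    (φ : G →* Matrix n n ℂ) (g : G) : (φ g⁻¹).trace = star (φ g).trace := by
  classical
  set H : Matrix n n ℂ := ∑ h : G, (φ h)ᴴ * φ h with hH
  have hpos : H.PosDef := by
    rw [hH, ← Finset.add_sum_erase _ _ (Finset.mem_univ (1 : G))]
    refine Matrix.PosDef.add_posSemidef ?_ ?_
    · simpa using (Matrix.PosDef.one : (1 : Matrix n n ℂ).PosDef)
    · exact Matrix.posSemidef_sum _ fun h _ => Matrix.posSemidef_conjTranspose_mul_self _
  have hinv : (φ g)ᴴ * H * φ g = H := by
    rw [hH, Finset.mul_sum, Finset.sum_mul]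
    refine Fintype.sum_equiv (Equiv.mulRight g) _ _ fun h => ?_
    simp [Matrix.mul_assoc, Matrix.conjTranspose_mul]
  have h1 : φ g * φ g⁻¹ = 1 := by rw [← map_mul]; simp
  have h2 : H * φ g⁻¹ = (φ g)ᴴ * H := by
    conv_lhs => rw [← hinv]
    rw [Matrix.mul_assoc, h1, Matrix.mul_one]
  have hu := (Matrix.isUnit_iff_isUnit_det H).1 hpos.isUnit
  have h3 : φ g⁻¹ = H⁻¹ * ((φ g)ᴴ * H) := by
    rw [← h2, ← Matrix.mul_assoc, Matrix.nonsing_inv_mul _ hu, Matrix.one_mul]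
  rw [h3, Matrix.trace_mul_comm, Matrix.mul_assoc, Matrix.mul_nonsing_inv _ hu, Matrix.mul_one,
    Matrix.trace_conjTranspose]

theorem mckayAux_char_inv {G : Type} [Group G] [Fintype G] (V : FDRep ℂ G) (g : G) :
    V.character g⁻¹ = star (V.character g) := by
  let b := Module.finBasis ℂ V
  have key := mckayAux_trace_inv
    ((LinearMap.toMatrixAlgEquiv b : (V →ₗ[ℂ] V) →* Matrix (Fin (finrank ℂ V)) (Fin (finrank ℂ V)) ℂ).comp V.ρ) g
  unfold FDRep.character
  rw [LinearMap.trace_eq_matrix_trace ℂ b, LinearMap.trace_eq_matrix_trace ℂ b]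
  exact key

open Matrix in
theorem mckayAux_unip (A : Matrix (Fin 2) (Fin 2) ℂ) (hd : A.det = 1) (ht : A.trace = 2)
    (n : ℕ) (hn : n ≠ 0) (hA : A ^ n = 1) : A = 1 := by
  have hN : (A - 1) * (A - 1) = 0 := by
    rw [Matrix.det_fin_two] at hd
    rw [Matrix.trace_fin_two] at ht
    ext i j
    fin_cases i <;> fin_cases j <;> simp [Matrix.mul_apply, Fin.sum_univ_two] <;>
      grind
  have hp : ∀ k : ℕ, A ^ k = 1 + (k : ℂ) • (A - 1) := by
    intro k
    induction k with
    | zero => simp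
    | succ k ih =>
      have hA1 : A = 1 + (A - 1) := by abel
      have : (A - 1) * A = A - 1 := by
        conv_lhs => rw [hA1]
        rw [add_sub_cancel, ]
        have : (A - 1) * (1 + (A - 1)) = A - 1 := by rw [mul_add, hN]; simp
        rwa [← hA1] at this
      rw [pow_succ, ih, add_mul, smul_mul_assoc, this]
      push_cast
      rw [add_smul, one_mul, one_smul]
      abel
  have := hp n
  rw [hA] at this
  have h0 : (n : ℂ) • (A - 1) = 0 := by simpa using this
  rcases smul_eq_zero.1 h0 with h | h
  · exact absurd (by exact_mod_cast h) hn
  · exact sub_eq_zero.1 h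

open Matrix in
theorem mckayAux_tr (A : Matrix (Fin 2) (Fin 2) ℂ) (hd : A.det = 1)
    (n : ℕ) (hn : n ≠ 0) (hA : A ^ n = 1) :
    ∃ t : ℝ, A.trace = t ∧ |t| ≤ 2 := by
  obtain ⟨l, hl⟩ := IsAlgClosed.exists_root A.charpoly
    (by rw [Matrix.charpoly_degree_eq_dim]; simp)
  have hroot : l ^ 2 - A.trace * l + 1 = 0 := by
    rw [Matrix.charpoly_fin_two] at hl
    simpa [hd, Polynomial.IsRoot] using hl
  have hev : Module.End.HasEigenvalue (Matrix.toLin' A) l := by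
    rw [Module.End.hasEigenvalue_iff_isRoot_charpoly, Matrix.charpoly_toLin']
    exact hl
  obtain ⟨v, hv⟩ := hev.exists_hasEigenvector
  have hln : l ^ n = 1 := by
    have h1 := hv.pow_apply n
    rw [← Matrix.toLin'_pow, hA] at h1
    have h2 : (l ^ n - 1) • v = 0 := by
      rw [sub_smul, ← h1]; simp
    rcases smul_eq_zero.1 h2 with h | h
    · exact sub_eq_zero.1 h
    · exact absurd h hv.2
  have hnorm : ‖l‖ = 1 := Complex.norm_eq_one_of_pow_eq_one hln hn
  have hl0 : l ≠ 0 := by rintro rfl; simp at hnorm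
  have hcc : l * (starRingEnd ℂ) l = 1 := by
    rw [Complex.mul_conj, Complex.normSq_eq_norm_sq, hnorm]; simp
  refine ⟨2 * l.re, ?_, ?_⟩
  · rw [← Complex.add_conj]
    apply mul_left_cancel₀ hl0
    linear_combination -hroot - hcc
  · rw [abs_mul, abs_two]
    have := Complex.abs_re_le_norm l
    linarith

/-- Pointwise inequality. -/
theorem mckayAux_pt (t : ℝ) (ht : |t| ≤ 2) (s u : ℂ) :
    ((t : ℂ) * s * star u).re ≤ Complex.normSq s + Complex.normSq u := by
  obtain ⟨h1, h2⟩ := abs_le.1 ht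
  simp [Complex.normSq_apply]
  nlinarith [mul_nonneg (sub_nonneg.2 h2) (sq_nonneg (s.re + u.re)),
    mul_nonneg (sub_nonneg.2 h2) (sq_nonneg (s.im + u.im)),
    mul_nonneg (sub_nonneg.2 h1) (sq_nonneg (s.re - u.re)),
    mul_nonneg (sub_nonneg.2 h1) (sq_nonneg (s.im - u.im))]

theorem mckayAux_pt_eq (t : ℝ) (ht : |t| ≤ 2) (s u : ℂ)
    (h : ((t : ℂ) * s * star u).re = Complex.normSq s + Complex.normSq u) :
    (t ≠ 2 → s + u = 0) ∧ (t ≠ -2 → s = u) := by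
  obtain ⟨h1, h2⟩ := abs_le.1 ht
  simp [Complex.normSq_apply] at h
  have key : (2 - t) * ((s.re + u.re)^2 + (s.im + u.im)^2) +
      (2 + t) * ((s.re - u.re)^2 + (s.im - u.im)^2) = 0 := by linear_combination (-4) * h
  have ka : 0 ≤ (2 - t) * ((s.re + u.re)^2 + (s.im + u.im)^2) :=
    mul_nonneg (by linarith) (by positivity)
  have kb : 0 ≤ (2 + t) * ((s.re - u.re)^2 + (s.im - u.im)^2) :=
    mul_nonneg (by linarith) (by positivity)
  constructor
  · intro hne
    have k1 : (2 - t) * ((s.re + u.re)^2 + (s.im + u.im)^2) = 0 := by linarith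
    have k2 := (mul_eq_zero.1 k1).resolve_left (by intro h; apply hne; linarith)
    apply Complex.ext <;> simp <;>
      nlinarith [sq_nonneg (s.re + u.re), sq_nonneg (s.im + u.im)]
  · intro hne
    have k1 : (2 + t) * ((s.re - u.re)^2 + (s.im - u.im)^2) = 0 := by linarith
    have k2 := (mul_eq_zero.1 k1).resolve_left (by intro h; apply hne; linarith)
    apply Complex.ext <;>
      nlinarith [sq_nonneg (s.re - u.re), sq_nonneg (s.im - u.im)]

theorem mckayAux_trivial {G : Type} [Group G] [Fintype G] (S : FDRep ℂ G) [Simple S]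
    (h : ∑ g : G, S.character g ≠ 0) (g : G) : S.character g = 1 := by
  have hc : ∀ g, (FDRep.of (Representation.trivial ℂ G ℂ)).character g = 1 := by
    intro g
    change LinearMap.trace ℂ ℂ (Representation.trivial ℂ G ℂ g) = 1
    have : Representation.trivial ℂ G ℂ g = 1 := rfl
    rw [this, LinearMap.trace_one]; simp
  have : Simple (FDRep.of (Representation.trivial ℂ G ℂ)) := by
    rw [FDRep.simple_iff_char_is_norm_one]
    simp [hc]
  have := invertibleOfNonzero (NeZero.ne (Nat.card G : ℂ))
  have h1 := FDRep.char_orthonormal S (FDRep.of (Representation.trivial ℂ G ℂ))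
  simp only [hc, mul_one] at h1
  split_ifs at h1 with hi
  · obtain ⟨i⟩ := hi
    rw [FDRep.char_iso i, hc]
  · exact absurd h1 (mul_ne_zero (inv_ne_zero (NeZero.ne _)) h)

theorem mckayAux_char_natV (G : Subgroup (Matrix.SpecialLinearGroup (Fin 2) ℂ)) (g : G) :
    (SL2.natV G).character g = (g : Matrix.SpecialLinearGroup (Fin 2) ℂ).1.trace := by
  change LinearMap.trace ℂ (Fin 2 → ℂ) (Matrix.toLin' _) = _
  rw [Matrix.trace_toLin'_eq]
  rfl

theorem mckayAux_norm {G : Type} [Group G] [Fintype G] (S : FDRep ℂ G) [hS : Simple S] :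
    ∑ g : G, Complex.normSq (S.character g) = Nat.card G := by
  have := (FDRep.simple_iff_char_is_norm_one S).1 hS
  simp only [mckayAux_char_inv] at this
  have h2 := congrArg Complex.re this
  rw [Complex.re_sum] at h2
  simpa [Complex.normSq_apply] using h2

/-- For a finite subgroup `G` of `SL(2, ℂ)` with `|G| ≥ 3`, the natural representation `V`,
and simple finite-dimensional complex representations `S`, `T` of `G`,
`dim Hom_G(T, V ⊗ S) ≤ 1`: in the McKay quiver of `G ⊂ SL(2, ℂ)` there is at most one
arrow between any two vertices. -/
theorem mckay_sl2_at_most_one_arrow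
    (G : Subgroup (Matrix.SpecialLinearGroup (Fin 2) ℂ)) [Finite G]
    (hG : 3 ≤ Nat.card G)
    (S T : FDRep ℂ G) [Simple S] [Simple T] :
    finrank ℂ (T ⟶ SL2.natV G ⊗ S) ≤ 1 := by
  have := Fintype.ofFinite G
  by_contra! hcon
  set n := Nat.card G with hn
  have hn0 : n ≠ 0 := by omega
  have hpow : ∀ g : G, (g : Matrix.SpecialLinearGroup (Fin 2) ℂ).1 ^ n = 1 := by
    intro g
    have h := pow_card_eq_one' (x := g)
    have h2 := congrArg (fun x : G => (x : Matrix.SpecialLinearGroup (Fin 2) ℂ).1) h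
    rw [← hn] at h2
    simpa only [Subgroup.coe_pow, Subgroup.coe_one, Matrix.SpecialLinearGroup.coe_pow, Matrix.SpecialLinearGroup.coe_one] using h2
  have htr : ∀ g : G, ∃ t : ℝ, (g : Matrix.SpecialLinearGroup (Fin 2) ℂ).1.trace = t ∧ |t| ≤ 2 :=
    fun g => mckayAux_tr _ g.1.2 n hn0 (hpow g)
  choose t ht htb using htr
  have ht2 : ∀ g : G, t g = 2 → g = 1 := by
    intro g h
    apply Subtype.ext
    apply Subtype.ext
    exact mckayAux_unip _ g.1.2 (by rw [ht, h]; simp) n hn0 (hpow g)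
  have htm2 : ∀ g : G, t g = -2 → (g : Matrix.SpecialLinearGroup (Fin 2) ℂ).1 = -1 := by
    intro g h
    rw [← neg_eq_iff_eq_neg]
    refine mckayAux_unip _ ?_ ?_ (2 * n) (by omega) ?_
    · rw [Matrix.det_neg, g.1.2]; simp
    · rw [Matrix.trace_neg, ht, h]; simp
    · rw [Even.neg_pow (even_two_mul n), mul_comm, pow_mul, hpow, one_pow]
  have t1 : t 1 = 2 := by
    have := ht 1
    simp at this
    apply Complex.ofReal_injective
    rw [← this]; simp
  have hinv := invertibleOfNonzero (NeZero.ne (Nat.card G : ℂ))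
  have hsum := FDRep.scalar_product_char_eq_finrank_equivariant T (SL2.natV G ⊗ S)
  rw [inv_mul_eq_iff_eq_mul₀ (NeZero.ne _)] at hsum
  simp only [FDRep.char_tensor, Pi.mul_apply, mckayAux_char_natV, ht, mckayAux_char_inv] at hsum
  have hre := congrArg Complex.re hsum
  rw [Complex.re_sum] at hre
  have hre2 : ∑ g : G, ((t g : ℂ) * S.character g * star (T.character g)).re ≥
      ∑ g : G, (Complex.normSq (S.character g) + Complex.normSq (T.character g)) := by
    rw [hre, Finset.sum_add_distrib, mckayAux_norm, mckayAux_norm, ← Nat.cast_mul,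
      Complex.natCast_re]
    have : (n + n : ℕ) ≤ Nat.card G * finrank ℂ (T ⟶ SL2.natV G ⊗ S) := by
      rw [← hn]; nlinarith
    exact_mod_cast this
  have hle : ∀ g ∈ (Finset.univ : Finset G), _ := fun g _ =>
    mckayAux_pt (t g) (htb g) (S.character g) (T.character g)
  have heq := (Finset.sum_eq_sum_iff_of_le hle).1 (le_antisymm (Finset.sum_le_sum hle) hre2)
  have hpt := fun g => mckayAux_pt_eq (t g) (htb g) _ _ (heq g (Finset.mem_univ g))
  have hS1 : S.character 1 = T.character 1 := (hpt 1).2 (by rw [t1]; norm_num)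
  have hdim : S.character 1 ≠ 0 := by
    intro h0
    rw [FDRep.char_one] at h0
    have h0' : finrank ℂ S = 0 := by exact_mod_cast h0
    have hss : Subsingleton S := finrank_zero_iff.1 h0'
    have hz : ∀ g : G, S.character g = 0 := by
      intro g
      unfold FDRep.character
      have : S.ρ g = 0 := LinearMap.ext fun x => Subsingleton.elim _ _
      rw [this, map_zero]
    have := mckayAux_norm S
    simp only [hz, map_zero, Finset.sum_const_zero] at this
    exact hn0 (by exact_mod_cast this.symm)
  have htot : ∑ g : G, S.character g + ∑ g : G, T.character g ≠ 0 := by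
    rw [← Finset.sum_add_distrib, Finset.sum_eq_single (1 : G)]
    · rw [← hS1, ← two_mul]
      exact mul_ne_zero two_ne_zero hdim
    · intro g _ hg
      exact (hpt g).1 fun h => hg (ht2 g h)
    · simp
  have hnz : ∀ g : G, S.character g ≠ 0 ∨ T.character g ≠ 0 := by
    intro g
    by_cases hs : ∑ g : G, S.character g = 0
    · right
      rw [mckayAux_trivial T (by intro h; rw [hs, h] at htot; simp at htot)]
      exact one_ne_zero
    · left
      rw [mckayAux_trivial S hs]
      exact one_ne_zero
  have hpm : ∀ g : G, t g = 2 ∨ t g = -2 := by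
    intro g
    by_contra! h
    have h1 := (hpt g).1 h.1
    have h2 := (hpt g).2 h.2
    rcases hnz g with h3 | h3
    · apply h3; linear_combination (h1 + h2) / 2
    · apply h3; linear_combination (h1 - h2) / 2
  have hinj : Function.Injective (fun g : G => (decide (t g = 2) : Bool)) := by
    intro g h hgh
    simp only [decide_eq_decide] at hgh
    by_cases hg : t g = 2
    · rw [ht2 g hg, ht2 h (hgh.1 hg)]
    · have hh : ¬ t h = 2 := fun hh => hg (hgh.2 hh)
      apply Subtype.ext
      apply Subtype.ext
      rw [htm2 g ((hpm g).resolve_left hg), htm2 h ((hpm h).resolve_left hh)]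
  have := Nat.card_le_card_of_injective _ hinj
  rw [Nat.card_eq_fintype_card (α := Bool), Fintype.card_bool] at this
  omega
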